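/- arXiv:2310.18678 — 5 statements merged into one kernel-verified Lean document; each statement's English description precedes it below -/
import Mathlib

section
/- Let T > 0, let V : ℝⁿ → ℝ be smooth, let Σ : ℝⁿ → ℝ^{n×n} be smooth with Σ(x) symmetric for every x, and let p : (0,T) × ℝⁿ → (0,∞) be smooth and satisfy the Fokker–Planck equation ∂_t p_t(x) = div( Σ(x) (∇ log p_t(x) + ∇V(x)) p_t(x) ) for all (t,x) ∈ (0,T) × ℝⁿ. Then the likelihood ratio function ℓ_t(x) := p_t(x) e^{V(x)} satisfies the partial differential equation ∂_t ℓ_t(x) = Σ_{i,j=1}^{n} Σ_{ij}(x) ∂²_{ij} ℓ_t(x) + ⟨ (div Σ)(x) − Σ(x) ∇V(x) , ∇ℓ_t(x) ⟩ for all (t,x) ∈ (0,T) × ℝⁿ. -/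
open MeasureTheory Matrix

/-- Gradient of a scalar field on `ℝⁿ` (components are partial derivatives). -/
noncomputable def vgrad {n : ℕ} (f : (Fin n → ℝ) → ℝ) (x : Fin n → ℝ) : Fin n → ℝ :=
  fun i => fderiv ℝ f x (Pi.single i 1)

/-- Divergence of a vector field on `ℝⁿ`. -/
noncomputable def vdiv {n : ℕ} (v : (Fin n → ℝ) → Fin n → ℝ) (x : Fin n → ℝ) : ℝ :=
  ∑ i, fderiv ℝ (fun y => v y i) x (Pi.single i 1)

/-- Divergence of a matrix field: `(div Σ)_i = ∑ j ∂_j Σ_{ij}`. -/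
noncomputable def mdiv {n : ℕ} (M : (Fin n → ℝ) → Matrix (Fin n) (Fin n) ℝ)
    (x : Fin n → ℝ) : Fin n → ℝ :=
  fun i => ∑ j, fderiv ℝ (fun y => M y i j) x (Pi.single j 1)

lemma smul_mulVec_vgrad_log_add {n : ℕ} {V f : (Fin n → ℝ) → ℝ}
    (M : Matrix (Fin n) (Fin n) ℝ) {y : Fin n → ℝ} (hV : DifferentiableAt ℝ V y)
    (hf : DifferentiableAt ℝ f y) (hpos : 0 < f y) :
    f y • (M *ᵥ (vgrad (fun z => Real.log (f z)) y + vgrad V y))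
      = M *ᵥ (Real.exp (-V y) • vgrad (fun z => f z * Real.exp (V z)) y) := by
  rw [← Matrix.mulVec_smul]
  congr 1
  ext j
  have hlog := (hf.hasFDerivAt.log hpos.ne').fderiv
  have hmul := (hf.hasFDerivAt.mul hV.hasFDerivAt.exp).fderiv
  have hmul' : fderiv ℝ (fun z => f z * Real.exp (V z)) y = _ := hmul
  simp only [vgrad, Pi.smul_apply, Pi.add_apply, smul_eq_mul, hlog, hmul',
    FunLike.coe_add, FunLike.coe_smul, Real.exp_neg]
  have := Real.exp_ne_zero (V y)
  have := hpos.ne'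
  field_simp
  ring

lemma vdiv_mulVec_exp_neg_smul {n : ℕ} {V : (Fin n → ℝ) → ℝ}
    {M : (Fin n → ℝ) → Matrix (Fin n) (Fin n) ℝ} {w : (Fin n → ℝ) → Fin n → ℝ}
    {x : Fin n → ℝ} (hV : DifferentiableAt ℝ V x)
    (hM : ∀ i j, DifferentiableAt ℝ (fun y => M y i j) x)
    (hw : ∀ j, DifferentiableAt ℝ (fun y => w y j) x) (hsymm : ∀ y, (M y).IsSymm) :
    vdiv (fun y => M y *ᵥ (Real.exp (-V y) • w y)) x * Real.exp (V x)
      = (∑ i, ∑ j, M x i j * vgrad (fun y => w y j) x i)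
        + (mdiv M x - M x *ᵥ vgrad V x) ⬝ᵥ w x := by
  have hterm (i : Fin n) :
      fderiv ℝ (fun y => (M y *ᵥ (Real.exp (-V y) • w y)) i) x (Pi.single i 1) * Real.exp (V x)
        = ∑ j, (M x i j * vgrad (fun y => w y j) x i
          + (fderiv ℝ (fun y => M y i j) x (Pi.single i 1) - M x i j * vgrad V x i) * w x j) := by
    have h := (HasFDerivAt.fun_sum (u := Finset.univ) fun j _ =>
      (hM i j).hasFDerivAt.fun_mul (hV.hasFDerivAt.fun_neg.exp.fun_mul (hw j).hasFDerivAt)).fderiv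
    simp only [Matrix.mulVec, dotProduct, Pi.smul_apply, smul_eq_mul]
    rw [h, _root_.sum_apply, Finset.sum_mul]
    refine Finset.sum_congr rfl fun j _ => ?_
    simp only [vgrad, FunLike.coe_add, FunLike.coe_smul, FunLike.coe_neg, Pi.add_apply,
      Pi.smul_apply, Pi.neg_apply, smul_eq_mul, Real.exp_neg]
    have := Real.exp_ne_zero (V x)
    field_simp
    ring
  have hentry (i j : Fin n) : (fun y => M y i j) = fun y => M y j i :=
    funext fun y => (hsymm y).apply j i
  simp only [vdiv, Finset.sum_mul, hterm, Finset.sum_add_distrib]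
  congr 1
  rw [Finset.sum_comm]
  simp only [dotProduct, mdiv, Matrix.mulVec, Pi.sub_apply, ← Finset.sum_sub_distrib,
    Finset.sum_mul]
  refine Finset.sum_congr rfl fun j _ => Finset.sum_congr rfl fun i _ => ?_
  rw [hentry i j, (hsymm x).apply j i]

/-- if `p` solves the Fokker–Planck equation, then the likelihood ratio
`ℓ_t(x) = p_t(x) e^{V(x)}` solves
`∂_t ℓ = ∑_{ij} Σ_{ij} ∂²_{ij} ℓ + ⟨div Σ − Σ ∇V, ∇ℓ⟩`. -/
theorem stmt_0 {n : ℕ} (T : ℝ) (hT : 0 < T)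
    (V : (Fin n → ℝ) → ℝ) (hV : ContDiff ℝ (⊤ : ℕ∞) V)
    (Sm : (Fin n → ℝ) → Matrix (Fin n) (Fin n) ℝ)
    (hSm : ∀ i j, ContDiff ℝ (⊤ : ℕ∞) fun x => Sm x i j)
    (hSymm : ∀ x, (Sm x).IsSymm)
    (p : ℝ → (Fin n → ℝ) → ℝ)
    (hpsm : ContDiffOn ℝ (⊤ : ℕ∞) (fun q : ℝ × (Fin n → ℝ) => p q.1 q.2)
      (Set.Ioo 0 T ×ˢ Set.univ))
    (hppos : ∀ t ∈ Set.Ioo (0:ℝ) T, ∀ x, 0 < p t x)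
    (hFP : ∀ t ∈ Set.Ioo (0:ℝ) T, ∀ x : Fin n → ℝ,
      deriv (fun s => p s x) t
        = vdiv (fun y =>
            p t y • (Sm y *ᵥ (vgrad (fun z => Real.log (p t z)) y + vgrad V y))) x) :
    ∀ t ∈ Set.Ioo (0:ℝ) T, ∀ x : Fin n → ℝ,
      deriv (fun s => p s x * Real.exp (V x)) t
        = (∑ i, ∑ j, Sm x i j *
            vgrad (fun y => vgrad (fun z => p t z * Real.exp (V z)) y j) x i)
          + (mdiv Sm x - Sm x *ᵥ vgrad V x) ⬝ᵥ
              vgrad (fun z => p t z * Real.exp (V z)) x := by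
  intro t ht x
  have hf : ContDiff ℝ (⊤ : ℕ∞) (p t) := by
    rw [← contDiffOn_univ]
    exact hpsm.comp (f := fun y : Fin n → ℝ => (t, y)) (contDiff_prodMk_right t).contDiffOn
      fun y _ => ⟨ht, Set.mem_univ y⟩
  have hℓ : ContDiff ℝ (⊤ : ℕ∞) fun z => p t z * Real.exp (V z) := hf.mul hV.exp
  have hgrad (j : Fin n) :
      DifferentiableAt ℝ (fun y => vgrad (fun z => p t z * Real.exp (V z)) y j) x :=
    ((hℓ.fderiv_right (m := 1) (by norm_cast)).clm_apply
      contDiff_const).differentiable one_ne_zero x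
  have hflux := funext fun y => smul_mulVec_vgrad_log_add (Sm y)
    (hV.differentiable (by simp) y) (hf.differentiable (by simp) y) (hppos t ht y)
  rw [deriv_mul_const_field, hFP t ht x, hflux]
  exact vdiv_mulVec_exp_neg_smul (hV.differentiable (by simp) x)
    (fun i j => (hSm i j).differentiable (by simp) x) hgrad hSymm
end

section
/- Let T > 0, let V : ℝⁿ → ℝ be smooth, let Σ : ℝⁿ → ℝ^{n×n} be smooth with Σ(x) symmetric for every x, and let p : (0,T) × ℝⁿ → (0,∞) be smooth and satisfy the Fokker–Planck equation ∂_t p_t(x) = div( Σ(x) (∇ log p_t(x) + ∇V(x)) p_t(x) ) for all (t,x) ∈ (0,T) × ℝⁿ. Define ℓ_t(x) := p_t(x) e^{V(x)} and the time-reversed likelihood ratio ℓ̄_s(x) := ℓ_{T−s}(x). Then ℓ̄ satisfies the Kolmogorov backward equation −∂_s ℓ̄_s(x) = Σ_{i,j=1}^{n} Σ_{ij}(x) ∂²_{ij} ℓ̄_s(x) + ⟨ (div Σ)(x) − Σ(x) ∇V(x) , ∇ℓ̄_s(x) ⟩ for all (s,x) ∈ (0,T) × ℝⁿ. -/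
open MeasureTheory Matrix

/-- Partial derivatives of a smooth function are differentiable. -/
theorem differentiable_vgrad_apply {n : ℕ} {f : (Fin n → ℝ) → ℝ}
    (hf : ContDiff ℝ (⊤ : ℕ∞) f) (j : Fin n) : Differentiable ℝ fun y => vgrad f y j := by
  have h : ContDiff ℝ 1 (fderiv ℝ f) :=
    hf.fderiv_right (WithTop.coe_le_coe.2 (le_top : (1 + 1 : ℕ∞) ≤ ⊤))
  exact (h.differentiable one_ne_zero).clm_apply (differentiable_const _)

/-- Multiplying the flux `Σ (∇ log q + ∇V) q` by `e^V` gives `Σ ∇(q e^V)`. -/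
theorem smul_vgrad_log_add_vgrad {n : ℕ} {q V : (Fin n → ℝ) → ℝ} {y : Fin n → ℝ}
    (hq : DifferentiableAt ℝ q y) (hV : DifferentiableAt ℝ V y) (hpos : 0 < q y) :
    q y • (vgrad (fun z => Real.log (q z)) y + vgrad V y)
      = Real.exp (-V y) • vgrad (fun z => q z * Real.exp (V z)) y := by
  ext i
  have h1 := hq.hasFDerivAt.log hpos.ne'
  have h2 := hq.hasFDerivAt.mul hV.hasFDerivAt.exp
  have h2' : HasFDerivAt (fun z => q z * Real.exp (V z)) _ y := h2
  have he : Real.exp (-V y) * Real.exp (V y) = 1 := by rw [← Real.exp_add]; simp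
  simp only [vgrad, h1.fderiv, h2'.fderiv, Pi.smul_apply, Pi.add_apply, smul_eq_mul,
    _root_.smul_apply, _root_.add_apply]
  rw [mul_add, mul_inv_cancel_left₀ hpos.ne']
  linear_combination (-(fderiv ℝ q y (Pi.single i 1))
    - q y * fderiv ℝ V y (Pi.single i 1)) * he

/-- Expansion of the divergence of `e^{-V} Σ ∇L` for a symmetric matrix field `Σ`. -/
theorem exp_mul_vdiv_exp_neg_smul_mulVec_vgrad {n : ℕ} {V L : (Fin n → ℝ) → ℝ}
    {M : (Fin n → ℝ) → Matrix (Fin n) (Fin n) ℝ} (hV : Differentiable ℝ V)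
    (hL : ContDiff ℝ (⊤ : ℕ∞) L) (hM : ∀ i j, Differentiable ℝ fun x => M x i j)
    (hSymm : ∀ x, (M x).IsSymm) (x : Fin n → ℝ) :
    vdiv (fun y => Real.exp (-V y) • (M y *ᵥ vgrad L y)) x * Real.exp (V x)
      = (∑ i, ∑ j, M x i j * vgrad (fun y => vgrad L y j) x i)
        + (mdiv M x - M x *ᵥ vgrad V x) ⬝ᵥ vgrad L x := by
  have hflux : ∀ i, fderiv ℝ (fun y => (Real.exp (-V y) • (M y *ᵥ vgrad L y)) i) x
      (Pi.single i 1) * Real.exp (V x)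
      = ∑ j, (M x i j * vgrad (fun y => vgrad L y j) x i
        + (fderiv ℝ (fun y => M y i j) x (Pi.single i 1)
          - M x i j * vgrad V x i) * vgrad L x j) := by
    intro i
    have hsum : HasFDerivAt (fun y => ∑ j, M y i j * vgrad L y j) _ x :=
      HasFDerivAt.fun_sum fun j _ => ((hM i j) x).hasFDerivAt.mul
        (differentiable_vgrad_apply hL j x).hasFDerivAt
    have h : HasFDerivAt (fun y => (Real.exp (-V y) • (M y *ᵥ vgrad L y)) i) _ x :=
      (hV x).hasFDerivAt.neg.exp.mul hsum
    have he : Real.exp (-V x) * Real.exp (V x) = 1 := by rw [← Real.exp_add]; simp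
    rw [h.fderiv]
    simp only [_root_.add_apply, _root_.smul_apply,
      _root_.sum_apply, _root_.neg_apply, smul_eq_mul,
      Pi.neg_apply, mulVec, dotProduct]
    rw [Finset.mul_sum, Finset.sum_mul, ← Finset.sum_add_distrib, Finset.sum_mul]
    refine Finset.sum_congr rfl fun j _ => ?_
    simp only [vgrad]
    generalize fderiv ℝ (fun y => fderiv ℝ L y (Pi.single j 1)) x (Pi.single i 1) = a
    linear_combination (M x i j * a
      + (fderiv ℝ (fun y => M y i j) x (Pi.single i 1)
        - M x i j * fderiv ℝ V x (Pi.single i 1)) * fderiv ℝ L x (Pi.single j 1)) * he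
  have hdrift : (mdiv M x - M x *ᵥ vgrad V x) ⬝ᵥ vgrad L x
      = ∑ i, ∑ j, (fderiv ℝ (fun y => M y i j) x (Pi.single i 1)
          - M x i j * vgrad V x i) * vgrad L x j := by
    rw [Finset.sum_comm]
    simp only [dotProduct, mdiv, mulVec, Pi.sub_apply, ← Finset.sum_sub_distrib,
      Finset.sum_mul]
    refine Finset.sum_congr rfl fun i _ => Finset.sum_congr rfl fun j _ => ?_
    simp only [fun y => (hSymm y).apply j i]
  rw [vdiv, Finset.sum_mul, hdrift, ← Finset.sum_add_distrib]
  refine Finset.sum_congr rfl fun i _ => ?_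
  rw [hflux, Finset.sum_add_distrib]

/-- the time-reversed likelihood ratio `ℓ̄_s(x) = p_{T−s}(x) e^{V(x)}` solves
the Kolmogorov backward equation
`−∂_s ℓ̄ = ∑_{ij} Σ_{ij} ∂²_{ij} ℓ̄ + ⟨div Σ − Σ ∇V, ∇ℓ̄⟩`. -/
theorem stmt_1 {n : ℕ} (T : ℝ) (hT : 0 < T)
    (V : (Fin n → ℝ) → ℝ) (hV : ContDiff ℝ (⊤ : ℕ∞) V)
    (Sm : (Fin n → ℝ) → Matrix (Fin n) (Fin n) ℝ)
    (hSm : ∀ i j, ContDiff ℝ (⊤ : ℕ∞) fun x => Sm x i j)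
    (hSymm : ∀ x, (Sm x).IsSymm)
    (p : ℝ → (Fin n → ℝ) → ℝ)
    (hpsm : ContDiffOn ℝ (⊤ : ℕ∞) (fun q : ℝ × (Fin n → ℝ) => p q.1 q.2)
      (Set.Ioo 0 T ×ˢ Set.univ))
    (hppos : ∀ t ∈ Set.Ioo (0:ℝ) T, ∀ x, 0 < p t x)
    (hFP : ∀ t ∈ Set.Ioo (0:ℝ) T, ∀ x : Fin n → ℝ,
      deriv (fun s => p s x) t
        = vdiv (fun y =>
            p t y • (Sm y *ᵥ (vgrad (fun z => Real.log (p t z)) y + vgrad V y))) x) :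
    ∀ s ∈ Set.Ioo (0:ℝ) T, ∀ x : Fin n → ℝ,
      -deriv (fun u => p (T - u) x * Real.exp (V x)) s
        = (∑ i, ∑ j, Sm x i j *
            vgrad (fun y => vgrad (fun z => p (T - s) z * Real.exp (V z)) y j) x i)
          + (mdiv Sm x - Sm x *ᵥ vgrad V x) ⬝ᵥ
              vgrad (fun z => p (T - s) z * Real.exp (V z)) x := by
  intro s hs x
  have ht : T - s ∈ Set.Ioo (0 : ℝ) T := ⟨by linarith [hs.2], by linarith [hs.1]⟩
  have hq : ContDiff ℝ (⊤ : ℕ∞) (p (T - s)) := by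
    rw [← contDiffOn_univ]
    exact hpsm.comp (g := fun q : ℝ × (Fin n → ℝ) => p q.1 q.2)
      (contDiff_const.prodMk contDiff_id).contDiffOn fun y _ => ⟨ht, Set.mem_univ y⟩
  have htop : ((⊤ : ℕ∞) : WithTop ℕ∞) ≠ 0 := by simp
  have hVd : Differentiable ℝ V := hV.differentiable htop
  have hflux : (fun y => p (T - s) y • (Sm y *ᵥ
      (vgrad (fun z => Real.log (p (T - s) z)) y + vgrad V y)))
      = fun y => Real.exp (-V y) •
        (Sm y *ᵥ vgrad (fun z => p (T - s) z * Real.exp (V z)) y) := by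
    ext1 y
    rw [← mulVec_smul, smul_vgrad_log_add_vgrad (hq.differentiable htop y) (hVd y)
      (hppos _ ht y), mulVec_smul]
  rw [deriv_mul_const_field, deriv_comp_const_sub (f := fun u => p u x), hFP _ ht x, hflux,
    neg_mul, neg_neg]
  exact exp_mul_vdiv_exp_neg_smul_mulVec_vgrad hVd (hq.mul hV.exp)
    (fun i j => (hSm i j).differentiable htop) hSymm x
end

section
/- Let V : ℝⁿ → ℝ be measurable with Z := ∫_{ℝⁿ} e^{−|x|² − V(x)} dx < ∞. Let P be a Borel probability measure on ℝⁿ with Lebesgue density p satisfying ∫ |x|² dP(x) < ∞. Then the negative part of the function x ↦ p(x) log( p(x) e^{V(x)} ) is Lebesgue integrable, so the relative entropy H(P | Q) := ∫ p(x) log( p(x) e^{V(x)} ) dx is well-defined with values in (−∞, ∞], and moreover H(P | Q) ≥ − ∫ |x|² dP(x) − log Z. -/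
open MeasureTheory
open scoped ENNReal

/-- The pointwise form of the Gibbs inequality. -/
theorem sub_le_mul_log_sub_mul_log {a b : ℝ} (ha : 0 ≤ a) (hb : 0 < b) :
    a - b ≤ a * Real.log a - a * Real.log b := by
  rcases ha.eq_or_lt with rfl | ha
  · simpa using hb.le
  · have h := mul_le_mul_of_nonneg_left (Real.log_le_sub_one_of_pos (div_pos hb ha)) ha.le
    rw [Real.log_div hb.ne' ha.ne', mul_sub, mul_sub, mul_div_cancel₀ _ ha.ne'] at h
    linarith

/-- A function bounded below by an integrable function has integrable negative part. -/
theorem integrable_max_neg_zero_of_le {α : Type*} [MeasurableSpace α] {μ : Measure α}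
    {f h : α → ℝ} (hf : AEStronglyMeasurable f μ) (hh : Integrable h μ) (hle : ∀ x, h x ≤ f x) :
    Integrable (fun x => max (-f x) 0) μ := by
  refine hh.mono (hf.neg.sup aestronglyMeasurable_const) (.of_forall fun x => ?_)
  rw [Real.norm_of_nonneg (le_max_right _ _), Real.norm_eq_abs]
  exact max_le ((neg_le_neg (hle x)).trans (neg_le_abs _)) (abs_nonneg _)

/-- The extended integral of a function dominates the integral of an integrable minorant. -/
theorem coe_integral_le_lintegral_sub_integral {α : Type*} [MeasurableSpace α] {μ : Measure α}
    {f h : α → ℝ} (hf : AEStronglyMeasurable f μ) (hh : Integrable h μ) (hle : ∀ x, h x ≤ f x) :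
    ((∫ x, h x ∂μ : ℝ) : EReal) ≤
      ((∫⁻ x, ENNReal.ofReal (f x) ∂μ : ℝ≥0∞) : EReal)
        - ((∫ x, max (-f x) 0 ∂μ : ℝ) : EReal) := by
  have hneg := integrable_max_neg_zero_of_le hf hh hle
  by_cases htop : ∫⁻ x, ENNReal.ofReal (f x) ∂μ = ∞
  · rw [htop, EReal.coe_ennreal_top, EReal.top_sub_coe]
    exact le_top
  · have hmeas : AEStronglyMeasurable (fun x => max (f x) 0) μ := hf.sup aestronglyMeasurable_const
    have hofReal : ∀ x, ENNReal.ofReal (max (f x) 0) = ENNReal.ofReal (f x) := fun x => by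
      simp [ENNReal.ofReal_max]
    have hpos : Integrable (fun x => max (f x) 0) μ := by
      refine (lintegral_ofReal_ne_top_iff_integrable hmeas
        (.of_forall fun x => le_max_right _ _)).1 ?_
      simpa only [hofReal] using htop
    have hval : ∫⁻ x, ENNReal.ofReal (f x) ∂μ = ENNReal.ofReal (∫ x, max (f x) 0 ∂μ) := by
      rw [ofReal_integral_eq_lintegral_ofReal hpos (.of_forall fun x => le_max_right _ _)]
      simp only [hofReal]
    have hnonneg : 0 ≤ ∫ x, max (f x) 0 ∂μ := integral_nonneg fun x => le_max_right _ _
    rw [hval, EReal.coe_ennreal_ofReal, max_eq_left hnonneg, ← EReal.coe_sub,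
      EReal.coe_le_coe_iff, ← integral_sub hpos hneg]
    refine integral_mono hh (hpos.sub hneg) fun x => (hle x).trans ?_
    rcases le_total (f x) 0 with h0 | h0
    · simp [h0]
    · simp [h0]

/-- if `Z = ∫ e^{−|x|²−V(x)} dx < ∞` and `P` has Lebesgue density `p` with finite
second moment, then the negative part of `x ↦ p(x) log(p(x) e^{V(x)})` is integrable — so the
relative entropy `H(P|Q) = ∫ p log(p e^V) dx` is well-defined with values in `(−∞,∞]` — and
(computing `H(P|Q)` in `EReal` as the integral of the positive part minus the integral of the
negative part) one has `H(P|Q) ≥ −∫ |x|² dP − log Z`. -/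
theorem stmt_8 {n : ℕ} (V : EuclideanSpace ℝ (Fin n) → ℝ) (hV : Measurable V)
    (hZfin : Integrable fun x : EuclideanSpace ℝ (Fin n) => Real.exp (-‖x‖ ^ 2 - V x))
    (Z : ℝ) (hZ : Z = ∫ x : EuclideanSpace ℝ (Fin n), Real.exp (-‖x‖ ^ 2 - V x))
    (p : EuclideanSpace ℝ (Fin n) → ℝ) (hpm : Measurable p) (hpnn : ∀ x, 0 ≤ p x)
    (hpint : Integrable p) (hp1 : ∫ x, p x = 1)
    (hmom : Integrable fun x : EuclideanSpace ℝ (Fin n) => ‖x‖ ^ 2 * p x) :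
    Integrable (fun x : EuclideanSpace ℝ (Fin n) =>
        max (-(p x * Real.log (p x * Real.exp (V x)))) 0) ∧
      ((∫⁻ x, ENNReal.ofReal (p x * Real.log (p x * Real.exp (V x))) : ℝ≥0∞) : EReal)
          - ((∫ x, max (-(p x * Real.log (p x * Real.exp (V x)))) 0 : ℝ) : EReal)
        ≥ ((-(∫ x, ‖x‖ ^ 2 * p x) - Real.log Z : ℝ) : EReal) := by
  have hZpos : 0 < Z := hZ ▸ integral_exp_pos hZfin
  set f : EuclideanSpace ℝ (Fin n) → ℝ := fun x => p x * Real.log (p x * Real.exp (V x)) with hf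
  set h : EuclideanSpace ℝ (Fin n) → ℝ := fun x =>
    p x - Real.exp (-‖x‖ ^ 2 - V x) / Z - ‖x‖ ^ 2 * p x - p x * Real.log Z with hh
  have hfm : AEStronglyMeasurable f := by
    have : Measurable f := by fun_prop
    exact this.aestronglyMeasurable
  have hdiff : Integrable fun x => p x - Real.exp (-‖x‖ ^ 2 - V x) / Z :=
    hpint.sub (hZfin.div_const Z)
  have hdiff_mom : Integrable fun x =>
      p x - Real.exp (-‖x‖ ^ 2 - V x) / Z - ‖x‖ ^ 2 * p x := hdiff.sub hmom
  have hhint : Integrable h := hdiff_mom.sub (hpint.mul_const _)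
  have hle : ∀ x, h x ≤ f x := by
    intro x
    have hgibbs := sub_le_mul_log_sub_mul_log (hpnn x)
      (div_pos (Real.exp_pos (-‖x‖ ^ 2 - V x)) hZpos)
    rw [Real.log_div (Real.exp_pos _).ne' hZpos.ne', Real.log_exp] at hgibbs
    have hfx : f x = p x * Real.log (p x) + p x * V x := by
      rcases (hpnn x).eq_or_lt with h0 | h0
      · simp [hf, ← h0]
      · simp only [hf]
        rw [Real.log_mul h0.ne' (Real.exp_pos _).ne', Real.log_exp, mul_add]
    rw [hfx]
    simp only [hh]
    linarith
  have hint : ∫ x, h x = -(∫ x, ‖x‖ ^ 2 * p x) - Real.log Z := by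
    simp only [hh]
    rw [integral_sub hdiff_mom (hpint.mul_const _), integral_sub hdiff hmom,
      integral_sub hpint (hZfin.div_const Z), integral_div, integral_mul_const, hp1, ← hZ,
      div_self hZpos.ne']
    ring
  refine ⟨integrable_max_neg_zero_of_le hfm hhint hle, ?_⟩
  rw [← hint]
  exact coe_integral_le_lintegral_sub_integral hfm hhint hle
end

section
/- Let T > 0, let V : ℝⁿ → ℝ be smooth, let Σ : ℝⁿ → ℝ^{n×n} be smooth with Σ(x) symmetric positive definite for every x, and let p : [0,T] × ℝⁿ → (0,∞) be continuous, smooth on (0,T) × ℝⁿ, with each p_t a probability density, and satisfy the Fokker–Planck equation ∂_t p_t(x) = div( Σ(x) (∇ log p_t(x) + ∇V(x)) p_t(x) ) on (0,T) × ℝⁿ. Set ℓ_t(x) := p_t(x) e^{V(x)} and H(t) := ∫ p_t(x) log ℓ_t(x) dx. Assume: (i) for every t ∈ [0,T] the functions x ↦ p_t(x) log ℓ_t(x) and x ↦ ⟨∇ log ℓ_t(x), Σ(x) ∇ log ℓ_t(x)⟩ p_t(x) are Lebesgue integrable; (ii) H is continuous on [0,T] and differentiable on (0,T) with H′(t) =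 ∫ ∂_t( p_t(x) log ℓ_t(x) ) dx; (iii) for every t ∈ (0,T) the vector field x ↦ e^{−V(x)} (1 + log ℓ_t(x)) Σ(x) ∇ℓ_t(x) has Lebesgue-integrable divergence whose integral over ℝⁿ vanishes. Then for all 0 ≤ t₀ ≤ t ≤ T the relative entropy identity holds: H(t₀) − H(t) = ∫_{t₀}^{t} ∫_{ℝⁿ} ⟨ ∇ log ℓ_u(x) , Σ(x) ∇ log ℓ_u(x) ⟩ p_u(x) dx du. -/
open MeasureTheory Matrix

open Set

lemma vgrad_add {n : ℕ} {f g : (Fin n → ℝ) → ℝ} {x : Fin n → ℝ} (hf : DifferentiableAt ℝ f x)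
    (hg : DifferentiableAt ℝ g x) : vgrad (fun y => f y + g y) x = vgrad f x + vgrad g x := by
  ext i
  simp only [vgrad, Pi.add_apply]
  rw [fderiv_fun_add hf hg]
  rfl

lemma vgrad_exp {n : ℕ} {f : (Fin n → ℝ) → ℝ} {x : Fin n → ℝ} (hf : DifferentiableAt ℝ f x) :
    vgrad (fun y => Real.exp (f y)) x = Real.exp (f x) • vgrad f x := by
  ext i
  simp only [vgrad, Pi.smul_apply]
  rw [fderiv_exp hf]
  rfl

lemma contDiff_vgrad_apply {n : ℕ} {f : (Fin n → ℝ) → ℝ} (hf : ContDiff ℝ (⊤ : ℕ∞) f) (i : Fin n) :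
    ContDiff ℝ (⊤ : ℕ∞) fun x => vgrad f x i :=
  (hf.fderiv_right (m := (⊤ : ℕ∞)) le_rfl).clm_apply contDiff_const

/-- Product rule for the divergence. -/
lemma vdiv_smul {n : ℕ} {f : (Fin n → ℝ) → ℝ} {w : (Fin n → ℝ) → Fin n → ℝ} {x : Fin n → ℝ}
    (hf : DifferentiableAt ℝ f x) (hw : ∀ i, DifferentiableAt ℝ (fun y => w y i) x) :
    vdiv (fun y => f y • w y) x = f x * vdiv w x + vgrad f x ⬝ᵥ w x := by
  simp only [vdiv, vgrad, dotProduct, Finset.mul_sum, ← Finset.sum_add_distrib]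
  refine Finset.sum_congr rfl fun i _ => ?_
  simp only [Pi.smul_apply, smul_eq_mul]
  rw [fderiv_fun_mul hf (hw i)]
  simp only [_root_.add_apply, _root_.smul_apply, smul_eq_mul]
  ring

/-- For `p = exp (g - V)`, the divergence of `e^{-V} (1 + g) Σ ∇e^g` splits into `1 + g` times the
divergence of the Fokker–Planck flux of `p`, plus the Fisher information density. -/
lemma vdiv_entropy_flux {n : ℕ} {V g p : (Fin n → ℝ) → ℝ} {Sm : (Fin n → ℝ) → Matrix (Fin n) (Fin n) ℝ}
    (hV : ContDiff ℝ (⊤ : ℕ∞) V) (hSm : ∀ i j, ContDiff ℝ (⊤ : ℕ∞) fun x => Sm x i j)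
    (hp : ContDiff ℝ (⊤ : ℕ∞) p) (hp0 : ∀ x, 0 < p x)
    (hg : ∀ x, g x = Real.log (p x) + V x) (x : Fin n → ℝ) :
    vdiv (fun y => (Real.exp (-V y) * (1 + g y)) •
        (Sm y *ᵥ vgrad (fun z => Real.exp (g z)) y)) x
      = (1 + g x) * vdiv (fun y =>
          p y • (Sm y *ᵥ (vgrad (fun z => Real.log (p z)) y + vgrad V y))) x
        + (vgrad g x ⬝ᵥ (Sm x *ᵥ vgrad g x)) * p x := by
  have hlog : ContDiff ℝ (⊤ : ℕ∞) fun z => Real.log (p z) := hp.log fun z => (hp0 z).ne'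
  have hgs : ContDiff ℝ (⊤ : ℕ∞) g := by
    rw [funext hg]
    exact hlog.add hV
  have htop : ((⊤ : ℕ∞) : WithTop ℕ∞) ≠ 0 := by simp
  have hgd : Differentiable ℝ g := hgs.differentiable htop
  have hgrad (y) : vgrad (fun z => Real.log (p z)) y + vgrad V y = vgrad g y := by
    rw [funext hg]
    exact (vgrad_add (hlog.differentiable htop y) (hV.differentiable htop y)).symm
  have hexp (y) : Real.exp (-V y) * Real.exp (g y) = p y := by
    rw [← Real.exp_add, hg, neg_add_cancel_comm_assoc, Real.exp_log (hp0 y)]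
  have hflux : (fun y => (Real.exp (-V y) * (1 + g y)) •
        (Sm y *ᵥ vgrad (fun z => Real.exp (g z)) y))
      = fun y => (1 + g y) • (p y • (Sm y *ᵥ vgrad g y)) := by
    funext y
    rw [vgrad_exp (hgd y), mulVec_smul, smul_smul, smul_smul, ← hexp y]
    ring_nf
  have hw (i) : DifferentiableAt ℝ (fun y => (p y • (Sm y *ᵥ vgrad g y)) i) x := by
    have : ContDiff ℝ (⊤ : ℕ∞) fun y => p y * ∑ j, Sm y i j * vgrad g y j :=
      hp.mul (ContDiff.sum fun j _ => (hSm i j).mul (contDiff_vgrad_apply hgs j))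
    exact this.differentiable htop x
  have hone : vgrad (fun y => 1 + g y) x = vgrad g x := by
    ext i
    simp only [vgrad, fderiv_const_add]
  simp only [hgrad, hflux]
  rw [vdiv_smul ((hgd x).const_add 1) hw, hone, dotProduct_smul, smul_eq_mul,
    mul_comm (p x) (_ ⬝ᵥ _)]

lemma deriv_mul_log_mul_const {f : ℝ → ℝ} {t c : ℝ} (hf : DifferentiableAt ℝ f t)
    (hft : f t ≠ 0) (hc : c ≠ 0) :
    deriv (fun s => f s * Real.log (f s * c)) t
      = (1 + Real.log (f t * c)) * deriv f t := by
  have h := hf.hasDerivAt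
  rw [(h.fun_mul ((h.mul_const c).log (mul_ne_zero hft hc))).deriv]
  field_simp
  ring

/-- relative entropy identity
`H(t₀) − H(t) = ∫_{t₀}^t ∫ ⟨∇ log ℓ_u, Σ ∇ log ℓ_u⟩ p_u dx du`. -/
theorem stmt_10 {n : ℕ} (T : ℝ) (hT : 0 < T)
    (V : (Fin n → ℝ) → ℝ) (hV : ContDiff ℝ (⊤ : ℕ∞) V)
    (Sm : (Fin n → ℝ) → Matrix (Fin n) (Fin n) ℝ)
    (hSm : ∀ i j, ContDiff ℝ (⊤ : ℕ∞) fun x => Sm x i j)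
    (hsym : ∀ x, (Sm x).IsSymm) (hpd : ∀ x, (Sm x).PosDef)
    (p : ℝ → (Fin n → ℝ) → ℝ)
    (hpcont : ContinuousOn (fun q : ℝ × (Fin n → ℝ) => p q.1 q.2)
      (Set.Icc 0 T ×ˢ Set.univ))
    (hpsm : ContDiffOn ℝ (⊤ : ℕ∞) (fun q : ℝ × (Fin n → ℝ) => p q.1 q.2)
      (Set.Ioo 0 T ×ˢ Set.univ))
    (hppos : ∀ t ∈ Set.Icc (0:ℝ) T, ∀ x, 0 < p t x)
    (hprob : ∀ t ∈ Set.Icc (0:ℝ) T, Integrable (p t) ∧ ∫ x, p t x = 1)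
    (hFP : ∀ t ∈ Set.Ioo (0:ℝ) T, ∀ x : Fin n → ℝ,
      deriv (fun s => p s x) t
        = vdiv (fun y =>
            p t y • (Sm y *ᵥ (vgrad (fun z => Real.log (p t z)) y + vgrad V y))) x)
    -- the likelihood ratio ℓ_t(x) = p_t(x) e^{V(x)}
    (ℓ : ℝ → (Fin n → ℝ) → ℝ) (hℓ : ∀ t x, ℓ t x = p t x * Real.exp (V x))
    -- the relative entropy H(t) = ∫ p_t log ℓ_t dx
    (H : ℝ → ℝ) (hH : ∀ t, H t = ∫ x, p t x * Real.log (ℓ t x))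
    -- (i) integrability of the entropy and Fisher-information integrands
    (hi : ∀ t ∈ Set.Icc (0:ℝ) T,
      Integrable (fun x => p t x * Real.log (ℓ t x)) ∧
      Integrable (fun x =>
        (vgrad (fun z => Real.log (ℓ t z)) x ⬝ᵥ
          (Sm x *ᵥ vgrad (fun z => Real.log (ℓ t z)) x)) * p t x))
    -- (ii) H is continuous on [0,T] and differentiable on (0,T), with derivative obtained
    -- by differentiating under the integral sign
    (hii₁ : ContinuousOn H (Set.Icc 0 T))
    (hii₂ : ∀ t ∈ Set.Ioo (0:ℝ) T,
      HasDerivAt H (∫ x, deriv (fun s => p s x * Real.log (ℓ s x)) t) t)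
    -- (iii) the divergence of x ↦ e^{−V}(1 + log ℓ_t) Σ ∇ℓ_t is integrable with vanishing
    -- integral
    (hiii : ∀ t ∈ Set.Ioo (0:ℝ) T,
      Integrable (fun x => vdiv (fun y =>
        (Real.exp (-V y) * (1 + Real.log (ℓ t y))) • (Sm y *ᵥ vgrad (ℓ t) y)) x) ∧
      ∫ x, vdiv (fun y =>
        (Real.exp (-V y) * (1 + Real.log (ℓ t y))) • (Sm y *ᵥ vgrad (ℓ t) y)) x = 0) :
    ∀ t₀ t : ℝ, 0 ≤ t₀ → t₀ ≤ t → t ≤ T →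
      H t₀ - H t
        = ∫ u in t₀..t, ∫ x,
            (vgrad (fun z => Real.log (ℓ u z)) x ⬝ᵥ
              (Sm x *ᵥ vgrad (fun z => Real.log (ℓ u z)) x)) * p u x := by
  have hpu : ∀ u ∈ Ioo (0:ℝ) T, ∀ x,
      ContDiffAt ℝ (⊤ : ℕ∞) (fun q : ℝ × (Fin n → ℝ) => p q.1 q.2) (u, x) := fun u hu x =>
    hpsm.contDiffAt ((isOpen_Ioo.prod isOpen_univ).mem_nhds ⟨hu, mem_univ x⟩)
  have hderiv : ∀ u ∈ Ioo (0:ℝ) T, HasDerivAt (fun s => -H s)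
      (∫ x, (vgrad (fun z => Real.log (ℓ u z)) x ⬝ᵥ
        (Sm x *ᵥ vgrad (fun z => Real.log (ℓ u z)) x)) * p u x) u := by
    intro u hu
    have huI := Ioo_subset_Icc_self hu
    have hps : ContDiff ℝ (⊤ : ℕ∞) (p u) := contDiff_iff_contDiffAt.2 fun x =>
      (hpu u hu x).comp x (contDiffAt_const.prodMk contDiffAt_id)
    have hpt (x) : DifferentiableAt ℝ (fun s => p s x) u :=
      ((hpu u hu x).comp u (contDiffAt_id.prodMk contDiffAt_const)).differentiableAt (by simp)
    have hℓexp : ℓ u = fun z => Real.exp (Real.log (ℓ u z)) := by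
      funext z
      rw [Real.exp_log]
      rw [hℓ]
      exact mul_pos (hppos u huI z) (Real.exp_pos _)
    have hpoint (x) : deriv (fun s => p s x * Real.log (ℓ s x)) u
        = vdiv (fun y => (Real.exp (-V y) * (1 + Real.log (ℓ u y))) •
            (Sm y *ᵥ vgrad (ℓ u) y)) x
          - (vgrad (fun z => Real.log (ℓ u z)) x ⬝ᵥ
            (Sm x *ᵥ vgrad (fun z => Real.log (ℓ u z)) x)) * p u x := by
      have hsplit := vdiv_entropy_flux (g := fun z => Real.log (ℓ u z)) hV hSm hps (hppos u huI)
        (fun z => by rw [hℓ, Real.log_mul (hppos u huI z).ne' (Real.exp_ne_zero _), Real.log_exp]) x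
      rw [← hℓexp, ← hFP u hu x] at hsplit
      rw [hsplit, add_sub_cancel_right]
      simp only [hℓ]
      exact deriv_mul_log_mul_const (hpt x) (hppos u huI x).ne' (Real.exp_ne_zero _)
    have h := (hii₂ u hu).neg
    simp only [hpoint] at h
    rw [integral_sub (hiii u hu).1 (hi u huI).2, (hiii u hu).2, zero_sub, neg_neg] at h
    exact h
  intro t₀ t h0 htt hT'
  have hsub : Ioo t₀ t ⊆ Ioo 0 T := Ioo_subset_Ioo h0 hT'
  have hcont : ContinuousOn (fun s => -H s) (Icc t₀ t) :=
    (hii₁.mono (Icc_subset_Icc h0 hT')).neg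
  have hquad (x) (v : Fin n → ℝ) : 0 ≤ v ⬝ᵥ (Sm x *ᵥ v) := by
    simpa using (hpd x).posSemidef.dotProduct_mulVec_nonneg v
  have hint := intervalIntegral.integrableOn_deriv_of_nonneg hcont
    (fun u hu => hderiv u (hsub hu)) fun u hu => integral_nonneg fun x =>
      mul_nonneg (hquad x _) (hppos u (Ioo_subset_Icc_self (hsub hu)) x).le
  rw [intervalIntegral.integral_eq_sub_of_hasDerivAt_of_le htt hcont
    (fun u hu => hderiv u (hsub hu))
    ((intervalIntegrable_iff_integrableOn_Ioc_of_le htt).2 hint)]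
  ring
end

section
/- Let T > 0, let V : ℝⁿ → ℝ be smooth, let Σ, A : ℝⁿ → ℝ^{n×n} be smooth with Σ(x), A(x) symmetric positive definite for every x and uniformly elliptic. Set G := A⁻¹, let d_G be the induced Riemannian distance and W_{2,G} the associated quadratic Wasserstein distance. Let p : [0,T] × ℝⁿ → (0,∞) be continuous, smooth on (0,T) × ℝⁿ, with each p_t a probability density with finite second moment, satisfying the Fokker–Planck equation ∂_t p_t(x) = div( Σ(x) (∇ log p_t(x) + ∇V(x)) p_t(x) ) on (0,T) × ℝⁿ; let P_t be the measure with density p_t and ℓ_t(x) := p_t(x) e^{V(x)}. Assume: (a) the entropy identity H(P_{t₀}|Q) − H(P_t|Q) = ∫_{t₀}^{t} ∫ ⟨∇ log ℓ_u(x), Σ(x) ∇ log ℓ_u(x)⟩ p_u(x) dx du holds for all 0 ≤ t₀ ≤ t ≤ T, with all integrals finite; (b) for Lebesgue-a.e. u ∈ [0,T] the metric derivative m(u) := lim_{h→0} W_{2,G}(P_{u+h}, P_u)/|h| exists and satisfies m(u)² = ∫ ⟨ Σ(x) ∇ log ℓ_u(x) , G(x) Σ(x) ∇ log ℓ_u(x)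 ⟩ p_u(x) dx. Then for all 0 ≤ t₀ ≤ t ≤ T: | H(P_t|Q) − H(P_{t₀}|Q) | ≤ ∫_{t₀}^{t} √( I_G(P_u|Q) ) · m(u) du, where I_G(P_u|Q) := ∫ ⟨∇ log ℓ_u(x), A(x) ∇ log ℓ_u(x)⟩ p_u(x) dx. Moreover, if Σ = κA for a constant κ > 0, this inequality is an equality. -/
open MeasureTheory Matrix
open scoped ENNReal

/-- An absolutely continuous curve from `x` to `y` in `ℝⁿ`, recorded via an integrable
a.e. derivative `deriv'` of which the curve is the primitive on `[0,1]`. -/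
structure ACCurve (n : ℕ) (x y : Fin n → ℝ) where
  toFun : ℝ → Fin n → ℝ
  deriv' : ℝ → Fin n → ℝ
  integrableOn : IntegrableOn deriv' (Set.Icc 0 1)
  isPrimitive : ∀ t ∈ Set.Icc (0:ℝ) 1,
    toFun t = toFun 0 + ∫ s in Set.Ioc (0:ℝ) t, deriv' s
  map_zero : toFun 0 = x
  map_one : toFun 1 = y

/-- Riemannian length `∫₀¹ √⟨G(γ(t)) γ̇(t), γ̇(t)⟩ dt` of an absolutely continuous curve. -/
noncomputable def riemLen {n : ℕ} (G : (Fin n → ℝ) → Matrix (Fin n) (Fin n) ℝ)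
    {x y : Fin n → ℝ} (c : ACCurve n x y) : ℝ :=
  ∫ t in Set.Icc (0:ℝ) 1, Real.sqrt ((G (c.toFun t) *ᵥ c.deriv' t) ⬝ᵥ c.deriv' t)

/-- Riemannian distance induced by the metric tensor `G`: infimum of lengths of absolutely
continuous curves joining `x` to `y`. -/
noncomputable def riemDist {n : ℕ} (G : (Fin n → ℝ) → Matrix (Fin n) (Fin n) ℝ)
    (x y : Fin n → ℝ) : ℝ :=
  sInf { L : ℝ | ∃ c : ACCurve n x y, L = riemLen G c }

/-- Quadratic Wasserstein distance associated with a ground distance `d`: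
`W₂(P,Q)² = inf over couplings π of ∫ d(x,y)² dπ`. -/
noncomputable def Wass2 {E : Type*} [MeasurableSpace E] (d : E → E → ℝ)
    (P Q : Measure E) : ℝ :=
  Real.sqrt (sInf { r : ℝ≥0∞ | ∃ π : Measure (E × E), IsProbabilityMeasure π ∧
      π.map Prod.fst = P ∧ π.map Prod.snd = Q ∧
      r = ∫⁻ q, ENNReal.ofReal (d q.1 q.2 ^ 2) ∂π }).toReal

/-- Cauchy–Schwarz inequality for a positive semidefinite real matrix. -/
theorem Matrix.PosSemidef.dotProduct_mulVec_sq_le {ι : Type*} [Fintype ι] [DecidableEq ι]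
    {M : Matrix ι ι ℝ} (hM : M.PosSemidef) (x y : ι → ℝ) :
    (x ⬝ᵥ (M *ᵥ y)) ^ 2 ≤ (x ⬝ᵥ (M *ᵥ x)) * (y ⬝ᵥ (M *ᵥ y)) := by
  have hsymm (a b : ι → ℝ) : a ⬝ᵥ (M *ᵥ b) = b ⬝ᵥ (M *ᵥ a) := by
    have ht : Mᵀ = M := by simpa using hM.isHermitian.eq
    rw [dotProduct_mulVec, ← mulVec_transpose, ht, dotProduct_comm]
  have h := LinearMap.BilinForm.apply_sq_le_of_symm (Matrix.toBilin' M)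
    (fun v => by
      rw [Matrix.toBilin'_apply']
      simpa using hM.dotProduct_mulVec_nonneg v)
    ⟨fun v w => by simpa [Matrix.toBilin'_apply'] using hsymm v w⟩ x y
  simpa only [Matrix.toBilin'_apply'] using h

/-- Cauchy–Schwarz between a metric `M` and its dual `M⁻¹`. -/
theorem Matrix.PosDef.dotProduct_sq_le {ι : Type*} [Fintype ι] [DecidableEq ι]
    {M : Matrix ι ι ℝ} (hM : M.PosDef) (x w : ι → ℝ) :
    (x ⬝ᵥ w) ^ 2 ≤ (x ⬝ᵥ (M *ᵥ x)) * (w ⬝ᵥ (M⁻¹ *ᵥ w)) := by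
  have hw : M *ᵥ (M⁻¹ *ᵥ w) = w := by
    rw [mulVec_mulVec, mul_nonsing_inv _ ((isUnit_iff_isUnit_det M).mp hM.isUnit), one_mulVec]
  have h := hM.posSemidef.dotProduct_mulVec_sq_le x (M⁻¹ *ᵥ w)
  rwa [hw, dotProduct_comm (M⁻¹ *ᵥ w)] at h

/-- Comparison of the dual norm of `S g` with the `S`-norm of `g`, for elliptic `M` and `S`. -/
theorem Matrix.PosDef.mulVec_inv_le_of_elliptic {ι : Type*} [Fintype ι] [DecidableEq ι]
    {M S : Matrix ι ι ℝ} (hM : M.PosDef) (hS : S.PosDef) {c C : ℝ} (hc : 0 < c)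
    (hSC : ∀ ξ : ι → ℝ, (S *ᵥ ξ) ⬝ᵥ ξ ≤ C * (ξ ⬝ᵥ ξ))
    (hMc : ∀ ξ : ι → ℝ, c * (ξ ⬝ᵥ ξ) ≤ (M *ᵥ ξ) ⬝ᵥ ξ) (hC : 0 ≤ C) (g : ι → ℝ) :
    (S *ᵥ g) ⬝ᵥ (M⁻¹ *ᵥ (S *ᵥ g)) ≤ C / c * (g ⬝ᵥ (S *ᵥ g)) := by
  set y := M⁻¹ *ᵥ (S *ᵥ g) with hy
  have hw : M *ᵥ y = S *ᵥ g := by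
    rw [hy, mulVec_mulVec, mul_nonsing_inv _ ((isUnit_iff_isUnit_det M).mp hM.isUnit),
      one_mulVec]
  have hcs := hS.posSemidef.dotProduct_mulVec_sq_le y g
  have h1 := hSC y
  have h2 := hMc y
  rw [hw] at h2
  have h3 : 0 ≤ g ⬝ᵥ (S *ᵥ g) := by simpa using hS.posSemidef.dotProduct_mulVec_nonneg g
  rw [dotProduct_comm y (S *ᵥ g), dotProduct_comm y (S *ᵥ y)] at hcs
  set q := (S *ᵥ g) ⬝ᵥ y
  have h4 : y ⬝ᵥ y ≤ q / c := by rw [le_div_iff₀ hc]; linarith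
  have h5 : q ^ 2 ≤ C / c * (g ⬝ᵥ (S *ᵥ g)) * q := by
    calc q ^ 2 ≤ (S *ᵥ y) ⬝ᵥ y * (g ⬝ᵥ (S *ᵥ g)) := hcs
      _ ≤ (C * (q / c)) * (g ⬝ᵥ (S *ᵥ g)) := by gcongr; exact h1.trans (by gcongr)
      _ = _ := by ring
  have h6 : 0 ≤ C / c * (g ⬝ᵥ (S *ᵥ g)) := by positivity
  by_contra! hlt
  nlinarith

/-- Comparison of the quadratic forms of two elliptic matrices. -/
theorem dotProduct_mulVec_le_of_elliptic {ι : Type*} [Fintype ι]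
    {M S : Matrix ι ι ℝ} {c C : ℝ} (hc : 0 < c) (hC : 0 ≤ C)
    (hSc : ∀ ξ : ι → ℝ, c * (ξ ⬝ᵥ ξ) ≤ (S *ᵥ ξ) ⬝ᵥ ξ)
    (hMC : ∀ ξ : ι → ℝ, (M *ᵥ ξ) ⬝ᵥ ξ ≤ C * (ξ ⬝ᵥ ξ)) (g : ι → ℝ) :
    g ⬝ᵥ (M *ᵥ g) ≤ C / c * (g ⬝ᵥ (S *ᵥ g)) := by
  rw [dotProduct_comm g (M *ᵥ g), dotProduct_comm g (S *ᵥ g)]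
  have h : g ⬝ᵥ g ≤ (S *ᵥ g) ⬝ᵥ g / c := by rw [le_div_iff₀ hc]; linarith [hSc g]
  calc (M *ᵥ g) ⬝ᵥ g ≤ C * (g ⬝ᵥ g) := hMC g
    _ ≤ C * ((S *ᵥ g) ⬝ᵥ g / c) := by gcongr
    _ = _ := by ring

/-- Integral Cauchy–Schwarz inequality from a pointwise one. -/
theorem integral_sq_le_of_sq_le_mul {α : Type*} [MeasurableSpace α] {μ : Measure α}
    {f a b : α → ℝ} (hf : Integrable f μ) (ha : Integrable a μ) (hb : Integrable b μ)
    (ha0 : ∀ x, 0 ≤ a x) (hb0 : ∀ x, 0 ≤ b x) (h : ∀ x, f x ^ 2 ≤ a x * b x) :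
    (∫ x, f x ∂μ) ^ 2 ≤ (∫ x, a x ∂μ) * ∫ x, b x ∂μ := by
  have key (s : ℝ) :
      0 ≤ (∫ x, a x ∂μ) * (s * s) + (2 * ∫ x, f x ∂μ) * s + ∫ x, b x ∂μ := by
    have hpt : 0 ≤ ∫ x, (a x * (s * s) + 2 * f x * s + b x) ∂μ := by
      refine integral_nonneg fun x => ?_
      rcases (ha0 x).eq_or_lt with h0 | h0
      · have : f x = 0 := by
          have := h x
          rw [← h0, zero_mul] at this
          exact pow_eq_zero_iff two_ne_zero |>.mp (le_antisymm this (sq_nonneg _))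
        simpa [← h0, this] using hb0 x
      · have : 0 ≤ a x * (a x * (s * s) + 2 * f x * s + b x) := by
          nlinarith [sq_nonneg (a x * s + f x), h x]
        exact nonneg_of_mul_nonneg_right this h0
    have ha' := ha.mul_const (s * s)
    have hf' := (hf.const_mul 2).mul_const s
    have hsum : ∫ x, (a x * (s * s) + 2 * f x * s) ∂μ = _ := integral_add ha' hf'
    have hsum' : ∫ x, (a x * (s * s) + 2 * f x * s + b x) ∂μ = _ := integral_add (ha'.add hf') hb
    rw [hsum', hsum, integral_mul_const,
      integral_mul_const, integral_const_mul] at hpt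
    exact hpt
  have hd := discrim_le_zero key
  rw [discrim] at hd
  linarith

/-- The spatial gradient of a function that is smooth on a cylinder is jointly continuous. -/
theorem continuousOn_vgrad {n : ℕ} {J : Set ℝ} (hJ : IsOpen J) {f : ℝ → (Fin n → ℝ) → ℝ}
    (hf : ContDiffOn ℝ (⊤ : ℕ∞) (fun q : ℝ × (Fin n → ℝ) => f q.1 q.2) (J ×ˢ Set.univ)) :
    ContinuousOn (fun q : ℝ × (Fin n → ℝ) => vgrad (f q.1) q.2) (J ×ˢ Set.univ) := by
  have hU : IsOpen (J ×ˢ (Set.univ : Set (Fin n → ℝ))) := hJ.prod isOpen_univ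
  refine continuousOn_pi.mpr fun i => ?_
  have hcont : ContinuousOn (fun q : ℝ × (Fin n → ℝ) =>
      fderiv ℝ (fun q : ℝ × (Fin n → ℝ) => f q.1 q.2) q (0, Pi.single i 1)) (J ×ˢ Set.univ) :=
    (hf.continuousOn_fderiv_of_isOpen hU (by simp)).clm_apply continuousOn_const
  refine hcont.congr fun q hq => ?_
  have hd : HasFDerivAt (fun q : ℝ × (Fin n → ℝ) => f q.1 q.2) _ (q.1, q.2) :=
    ((hf.contDiffAt (hU.mem_nhds hq)).differentiableAt (by simp)).hasFDerivAt
  have := (hd.comp q.2 (hasFDerivAt_prodMk_right (𝕜 := ℝ) q.1 q.2)).fderiv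
  exact congrArg (fun L : (Fin n → ℝ) →L[ℝ] ℝ => L (Pi.single i 1)) this

/-- Integrals over the fibres of a function continuous on a cylinder are measurable in the
parameter. -/
theorem ContinuousOn.aestronglyMeasurable_integral_fibre {n : ℕ} {J : Set ℝ}
    (hJ : MeasurableSet J) {f : ℝ → (Fin n → ℝ) → ℝ}
    (hf : ContinuousOn (fun q : ℝ × (Fin n → ℝ) => f q.1 q.2) (J ×ˢ Set.univ)) :
    AEStronglyMeasurable (fun u => ∫ x, f u x) (volume.restrict J) := by
  have h : AEStronglyMeasurable (fun q : ℝ × (Fin n → ℝ) => f q.1 q.2)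
      ((volume.restrict J).prod volume) := by
    have h := hf.aestronglyMeasurable (μ := (volume : Measure ℝ).prod volume)
      (hJ.prod MeasurableSet.univ)
    rwa [← Measure.prod_restrict, Measure.restrict_univ] at h
  exact h.integral_prod_right'

/-- given the entropy identity and the metric-derivative formula, the
relative entropy satisfies
`|H(P_t|Q) − H(P_{t₀}|Q)| ≤ ∫_{t₀}^t √(I_G(P_u|Q)) · m(u) du`,
with equality when `Σ = κ A` for a constant `κ > 0`. -/
theorem stmt_15 {n : ℕ} (T : ℝ) (hT : 0 < T)
    (V : (Fin n → ℝ) → ℝ) (hV : ContDiff ℝ (⊤ : ℕ∞) V)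
    (Sm A : (Fin n → ℝ) → Matrix (Fin n) (Fin n) ℝ)
    (hSmc : ∀ i j, ContDiff ℝ (⊤ : ℕ∞) fun x => Sm x i j)
    (hAc : ∀ i j, ContDiff ℝ (⊤ : ℕ∞) fun x => A x i j)
    (hSsym : ∀ x, (Sm x).IsSymm) (hSpd : ∀ x, (Sm x).PosDef)
    (hAsym : ∀ x, (A x).IsSymm) (hApd : ∀ x, (A x).PosDef)
    (c C : ℝ) (hc : 0 < c) (hcC : c ≤ C)
    (hellS : ∀ (x ξ : Fin n → ℝ),
      c * (ξ ⬝ᵥ ξ) ≤ (Sm x *ᵥ ξ) ⬝ᵥ ξ ∧ (Sm x *ᵥ ξ) ⬝ᵥ ξ ≤ C * (ξ ⬝ᵥ ξ))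
    (hellA : ∀ (x ξ : Fin n → ℝ),
      c * (ξ ⬝ᵥ ξ) ≤ (A x *ᵥ ξ) ⬝ᵥ ξ ∧ (A x *ᵥ ξ) ⬝ᵥ ξ ≤ C * (ξ ⬝ᵥ ξ))
    -- the metric tensor G = A⁻¹
    (G : (Fin n → ℝ) → Matrix (Fin n) (Fin n) ℝ) (hG : ∀ x, G x = (A x)⁻¹)
    (p : ℝ → (Fin n → ℝ) → ℝ)
    (hpcont : ContinuousOn (fun q : ℝ × (Fin n → ℝ) => p q.1 q.2)
      (Set.Icc 0 T ×ˢ Set.univ))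
    (hpsm : ContDiffOn ℝ (⊤ : ℕ∞) (fun q : ℝ × (Fin n → ℝ) => p q.1 q.2)
      (Set.Ioo 0 T ×ˢ Set.univ))
    (hppos : ∀ t ∈ Set.Icc (0:ℝ) T, ∀ x, 0 < p t x)
    (hprob : ∀ t ∈ Set.Icc (0:ℝ) T, Integrable (p t) ∧ ∫ x, p t x = 1)
    (hmom : ∀ t ∈ Set.Icc (0:ℝ) T, Integrable fun x => (x ⬝ᵥ x) * p t x)
    (hFP : ∀ t ∈ Set.Ioo (0:ℝ) T, ∀ x : Fin n → ℝ,
      deriv (fun s => p s x) t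
        = vdiv (fun y =>
            p t y • (Sm y *ᵥ (vgrad (fun z => Real.log (p t z)) y + vgrad V y))) x)
    -- the curve of time-marginal probability measures
    (P : ℝ → Measure (Fin n → ℝ))
    (hP : ∀ t, P t = volume.withDensity fun x => ENNReal.ofReal (p t x))
    -- the likelihood ratio ℓ_t(x) = p_t(x) e^{V(x)}
    (ℓ : ℝ → (Fin n → ℝ) → ℝ) (hℓ : ∀ t x, ℓ t x = p t x * Real.exp (V x))
    -- the relative entropy H(t) = H(P_t|Q) and the relative Fisher information I_G(P_t|Q)
    (H : ℝ → ℝ) (hH : ∀ t, H t = ∫ x, p t x * Real.log (ℓ t x))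
    (I : ℝ → ℝ) (hI : ∀ u, I u = ∫ x,
      (vgrad (fun z => Real.log (ℓ u z)) x ⬝ᵥ
        (A x *ᵥ vgrad (fun z => Real.log (ℓ u z)) x)) * p u x)
    -- (a) the entropy identity, with all integrals finite
    (hfinFish : ∀ u ∈ Set.Icc (0:ℝ) T,
      Integrable (fun x => (vgrad (fun z => Real.log (ℓ u z)) x ⬝ᵥ
        (Sm x *ᵥ vgrad (fun z => Real.log (ℓ u z)) x)) * p u x) ∧
      Integrable (fun x => (vgrad (fun z => Real.log (ℓ u z)) x ⬝ᵥ
        (A x *ᵥ vgrad (fun z => Real.log (ℓ u z)) x)) * p u x) ∧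
      Integrable (fun x => p u x * Real.log (ℓ u x)))
    (hent : ∀ t₀ t : ℝ, 0 ≤ t₀ → t₀ ≤ t → t ≤ T →
      H t₀ - H t
        = ∫ u in t₀..t, ∫ x,
            (vgrad (fun z => Real.log (ℓ u z)) x ⬝ᵥ
              (Sm x *ᵥ vgrad (fun z => Real.log (ℓ u z)) x)) * p u x)
    -- (b) the metric derivative m(u) exists a.e. and
    -- m(u)² = ∫ ⟨Σ ∇ log ℓ_u, G Σ ∇ log ℓ_u⟩ p_u dx
    (m : ℝ → ℝ)
    (hmet : ∀ᵐ u ∂(volume.restrict (Set.Icc (0:ℝ) T)),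
      Filter.Tendsto (fun h : ℝ => Wass2 (riemDist G) (P (u + h)) (P u) / |h|)
        (nhdsWithin 0 {(0:ℝ)}ᶜ) (nhds (m u)) ∧
      m u ^ 2 = ∫ x,
        ((Sm x *ᵥ vgrad (fun z => Real.log (ℓ u z)) x) ⬝ᵥ
          (G x *ᵥ (Sm x *ᵥ vgrad (fun z => Real.log (ℓ u z)) x))) * p u x) :
    (∀ t₀ t : ℝ, 0 ≤ t₀ → t₀ ≤ t → t ≤ T →
      |H t - H t₀| ≤ ∫ u in t₀..t, Real.sqrt (I u) * m u) ∧
    (∀ κ : ℝ, 0 < κ → (∀ x, Sm x = κ • A x) →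
      ∀ t₀ t : ℝ, 0 ≤ t₀ → t₀ ≤ t → t ≤ T →
        |H t - H t₀| = ∫ u in t₀..t, Real.sqrt (I u) * m u) := by
  have hC : 0 ≤ C := hc.le.trans hcC
  set g : ℝ → (Fin n → ℝ) → Fin n → ℝ := fun u => vgrad fun z => Real.log (ℓ u z) with hg
  set F : ℝ → ℝ := fun u => ∫ x, (g u x ⬝ᵥ (Sm x *ᵥ g u x)) * p u x with hF
  set D : ℝ → ℝ := fun u => ∫ x, ((Sm x *ᵥ g u x) ⬝ᵥ (G x *ᵥ (Sm x *ᵥ g u x))) * p u x with hD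
  have hU : IsOpen (Set.Ioo (0:ℝ) T) := isOpen_Ioo
  have hIcc : Set.Ioo (0:ℝ) T ⊆ Set.Icc 0 T := Set.Ioo_subset_Icc_self
  have hgcont : ContinuousOn (fun q : ℝ × (Fin n → ℝ) => g q.1 q.2)
      (Set.Ioo 0 T ×ˢ Set.univ) := by
    refine continuousOn_vgrad (f := fun u z => Real.log (ℓ u z)) hU ?_
    simp only [hℓ]
    refine ContDiffOn.log (hpsm.mul (hV.exp.comp contDiff_snd).contDiffOn) fun q hq => ?_
    exact (mul_pos (hppos q.1 (hIcc hq.1) q.2) (Real.exp_pos _)).ne'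
  have hSq : ContinuousOn (fun q : ℝ × (Fin n → ℝ) => Sm q.2) (Set.Ioo 0 T ×ˢ Set.univ) :=
    ((continuous_matrix fun i j => (hSmc i j).continuous).comp continuous_snd).continuousOn
  have hAx : Continuous A := continuous_matrix fun i j => (hAc i j).continuous
  have hAq : ContinuousOn (fun q : ℝ × (Fin n → ℝ) => A q.2) (Set.Ioo 0 T ×ˢ Set.univ) :=
    (hAx.comp continuous_snd).continuousOn
  have hGx : Continuous G := by
    have : G = fun x => (A x).det⁻¹ • (A x).adjugate := by
      funext x
      rw [hG, Matrix.inv_def, Ring.inverse_eq_inv']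
    rw [this]
    exact (hAx.matrix_det.inv₀ fun x => (hApd x).det_pos.ne').smul hAx.matrix_adjugate
  have hGq : ContinuousOn (fun q : ℝ × (Fin n → ℝ) => G q.2) (Set.Ioo 0 T ×ˢ Set.univ) :=
    (hGx.comp continuous_snd).continuousOn
  have hpq : ContinuousOn (fun q : ℝ × (Fin n → ℝ) => p q.1 q.2) (Set.Ioo 0 T ×ˢ Set.univ) :=
    hpsm.continuousOn
  have hSg : ContinuousOn (fun q : ℝ × (Fin n → ℝ) => Sm q.2 *ᵥ g q.1 q.2)
      (Set.Ioo 0 T ×ˢ Set.univ) := by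
    rw [continuousOn_iff_continuous_domRestrict] at *
    exact hSq.matrix_mulVec hgcont
  have hAcont : ContinuousOn (fun q : ℝ × (Fin n → ℝ) =>
      (g q.1 q.2 ⬝ᵥ (A q.2 *ᵥ g q.1 q.2)) * p q.1 q.2) (Set.Ioo 0 T ×ˢ Set.univ) := by
    rw [continuousOn_iff_continuous_domRestrict] at *
    exact (hgcont.dotProduct (hAq.matrix_mulVec hgcont)).mul hpq
  have hDcont : ContinuousOn (fun q : ℝ × (Fin n → ℝ) =>
      ((Sm q.2 *ᵥ g q.1 q.2) ⬝ᵥ (G q.2 *ᵥ (Sm q.2 *ᵥ g q.1 q.2))) * p q.1 q.2)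
      (Set.Ioo 0 T ×ˢ Set.univ) := by
    rw [continuousOn_iff_continuous_domRestrict] at *
    exact (hSg.dotProduct (hGq.matrix_mulVec hSg)).mul hpq
  have hImeas : AEStronglyMeasurable I (volume.restrict (Set.Ioo 0 T)) := by
    rw [funext hI]
    exact hAcont.aestronglyMeasurable_integral_fibre
      (f := fun u x => (g u x ⬝ᵥ (A x *ᵥ g u x)) * p u x) measurableSet_Ioo
  have hDmeas : AEStronglyMeasurable D (volume.restrict (Set.Ioo 0 T)) :=
    hDcont.aestronglyMeasurable_integral_fibre
      (f := fun u x => ((Sm x *ᵥ g u x) ⬝ᵥ (G x *ᵥ (Sm x *ᵥ g u x))) * p u x) measurableSet_Ioo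
  have hS0 (x v : Fin n → ℝ) : 0 ≤ v ⬝ᵥ (Sm x *ᵥ v) := by
    simpa using (hSpd x).posSemidef.dotProduct_mulVec_nonneg v
  have hA0 (x v : Fin n → ℝ) : 0 ≤ v ⬝ᵥ (A x *ᵥ v) := by
    simpa using (hApd x).posSemidef.dotProduct_mulVec_nonneg v
  have hG0 (x v : Fin n → ℝ) : 0 ≤ v ⬝ᵥ (G x *ᵥ v) := by
    simpa [hG] using (hApd x).inv.posSemidef.dotProduct_mulVec_nonneg v
  have hGS (u : ℝ) (x : Fin n → ℝ) : (Sm x *ᵥ g u x) ⬝ᵥ (G x *ᵥ (Sm x *ᵥ g u x))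
      ≤ C / c * (g u x ⬝ᵥ (Sm x *ᵥ g u x)) := by
    rw [hG]
    exact (hApd x).mulVec_inv_le_of_elliptic (hSpd x) hc (fun ξ => (hellS x ξ).2)
      (fun ξ => (hellA x ξ).1) hC _
  have hDint : ∀ u ∈ Set.Ioo (0:ℝ) T, Integrable fun x =>
      ((Sm x *ᵥ g u x) ⬝ᵥ (G x *ᵥ (Sm x *ᵥ g u x))) * p u x := by
    intro u hu
    refine ((hfinFish u (hIcc hu)).1.const_mul (C / c)).mono' ?_ (ae_of_all _ fun x => ?_)
    · have : Continuous fun x : Fin n → ℝ =>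
          ((Sm x *ᵥ g u x) ⬝ᵥ (G x *ᵥ (Sm x *ᵥ g u x))) * p u x :=
        hDcont.comp_continuous (continuous_const.prodMk continuous_id)
          (fun x => ⟨hu, Set.mem_univ _⟩)
      exact this.aestronglyMeasurable
    · have hp := (hppos u (hIcc hu) x).le
      rw [Real.norm_of_nonneg (mul_nonneg (hG0 _ _) hp), ← mul_assoc]
      exact mul_le_mul_of_nonneg_right (hGS u x) hp
  have hF0 : ∀ u ∈ Set.Icc (0:ℝ) T, 0 ≤ F u := fun u hu =>
    integral_nonneg fun x => mul_nonneg (hS0 _ _) (hppos u hu x).le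
  have hI0 : ∀ u ∈ Set.Icc (0:ℝ) T, 0 ≤ I u := fun u hu => by
    rw [hI]
    exact integral_nonneg fun x => mul_nonneg (hA0 _ _) (hppos u hu x).le
  have hcs : ∀ u ∈ Set.Ioo (0:ℝ) T, F u ≤ √(I u) * √(D u) := by
    intro u hu
    have hfin := hfinFish u (hIcc hu)
    have hp x := (hppos u (hIcc hu) x).le
    rw [← Real.sqrt_mul (hI0 u (hIcc hu)), hI u]
    refine Real.le_sqrt_of_sq_le ?_
    refine integral_sq_le_of_sq_le_mul hfin.1 hfin.2.1 (hDint u hu)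
      (fun x => mul_nonneg (hA0 _ _) (hp x)) (fun x => mul_nonneg (hG0 _ _) (hp x)) fun x => ?_
    have h := (hApd x).dotProduct_sq_le (g u x) (Sm x *ᵥ g u x)
    rw [← hG] at h
    rw [mul_pow, mul_mul_mul_comm, ← sq (p u x)]
    exact mul_le_mul_of_nonneg_right h (sq_nonneg _)
  have hIF : ∀ u ∈ Set.Ioo (0:ℝ) T, I u ≤ C / c * F u := by
    intro u hu
    have hfin := hfinFish u (hIcc hu)
    rw [hI, hF, ← integral_const_mul]
    refine integral_mono hfin.2.1 (hfin.1.const_mul _) fun x => ?_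
    have h := dotProduct_mulVec_le_of_elliptic hc hC (fun ξ => (hellS x ξ).1)
      (fun ξ => (hellA x ξ).2) (g u x)
    simpa only [mul_assoc] using mul_le_mul_of_nonneg_right h (hppos u (hIcc hu) x).le
  have hDF : ∀ u ∈ Set.Ioo (0:ℝ) T, D u ≤ C / c * F u := by
    intro u hu
    rw [hF, ← integral_const_mul]
    refine integral_mono (hDint u hu) ((hfinFish u (hIcc hu)).1.const_mul _) fun x => ?_
    simpa only [mul_assoc] using
      mul_le_mul_of_nonneg_right (hGS u x) (hppos u (hIcc hu) x).le
  have hm : ∀ᵐ u ∂(volume.restrict (Set.Ioo (0:ℝ) T)), m u = √(D u) := by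
    filter_upwards [ae_mono (Measure.restrict_mono hIcc le_rfl) hmet] with u hu
    have hm0 : 0 ≤ m u := ge_of_tendsto hu.1
      (.of_forall fun h => div_nonneg (Real.sqrt_nonneg _) (abs_nonneg _))
    rw [show D u = m u ^ 2 from hu.2.symm, Real.sqrt_sq hm0]
  have hle (t₀ t : ℝ) (h0 : 0 ≤ t₀) (hT' : t ≤ T) :
      volume.restrict (Set.Ioc t₀ t) ≤ volume.restrict (Set.Ioo 0 T) := by
    rw [Measure.restrict_congr_set (Ioo_ae_eq_Ioc (a := (0:ℝ)) (b := T))]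
    exact Measure.restrict_mono (Set.Ioc_subset_Ioc h0 hT') le_rfl
  have habs (t₀ t : ℝ) (h0 : 0 ≤ t₀) (h : t₀ ≤ t) (hT' : t ≤ T) :
      |H t - H t₀| = ∫ u in t₀..t, F u := by
    rw [abs_sub_comm, hent t₀ t h0 h hT']
    exact abs_of_nonneg (intervalIntegral.integral_nonneg h fun u hu =>
      hF0 u ⟨h0.trans hu.1, hu.2.trans hT'⟩)
  refine ⟨fun t₀ t h0 h hT' => ?_, fun κ hκ hSA t₀ t h0 h hT' => ?_⟩
  · rw [habs t₀ t h0 h hT', intervalIntegral.integral_of_le h,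
      intervalIntegral.integral_of_le h]
    have hmem := ae_mono (hle t₀ t h0 hT') (ae_restrict_mem measurableSet_Ioo)
    have hmt := ae_mono (hle t₀ t h0 hT') hm
    by_cases hFi : IntegrableOn F (Set.Ioc t₀ t)
    · refine integral_mono_ae hFi ?_ ?_
      · have hmeas : AEStronglyMeasurable (fun u => √(I u) * √(D u))
            (volume.restrict (Set.Ioc t₀ t)) :=
          ((Real.continuous_sqrt.comp_aestronglyMeasurable hImeas).mul
            (Real.continuous_sqrt.comp_aestronglyMeasurable hDmeas)).mono_measure
              (hle t₀ t h0 hT')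
        have hint : Integrable (fun u => √(I u) * √(D u)) (volume.restrict (Set.Ioc t₀ t)) := by
          refine (hFi.const_mul (C / c)).mono' hmeas ?_
          filter_upwards [hmem] with u hu
          rw [Real.norm_of_nonneg (by positivity)]
          have hnn : 0 ≤ C / c * F u := mul_nonneg (by positivity) (hF0 u (hIcc hu))
          calc √(I u) * √(D u) ≤ √(C / c * F u) * √(C / c * F u) := by
                gcongr
                exacts [hIF u hu, hDF u hu]
            _ = C / c * F u := Real.mul_self_sqrt hnn
        refine hint.congr ?_
        filter_upwards [hmt] with u hu
        rw [hu]
      · filter_upwards [hmt, hmem] with u hu hu'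
        rw [hu]
        exact hcs u hu'
    · rw [integral_undef hFi]
      refine integral_nonneg_of_ae ?_
      filter_upwards [hmt] with u hu
      rw [hu]
      exact mul_nonneg (Real.sqrt_nonneg _) (Real.sqrt_nonneg _)
  · rw [habs t₀ t h0 h hT', intervalIntegral.integral_of_le h,
      intervalIntegral.integral_of_le h]
    refine integral_congr_ae ?_
    filter_upwards [ae_mono (hle t₀ t h0 hT') (ae_restrict_mem measurableSet_Ioo),
      ae_mono (hle t₀ t h0 hT') hm] with u hu hmu
    have hFI : F u = κ * I u := by
      rw [hI, hF, ← integral_const_mul]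
      simp only [hSA, smul_mulVec, dotProduct_smul, smul_eq_mul, mul_assoc, hg]
    have hDI : D u = κ ^ 2 * I u := by
      rw [hI, hD, ← integral_const_mul]
      refine integral_congr_ae (ae_of_all _ fun x => ?_)
      have hinv : G x *ᵥ (A x *ᵥ g u x) = g u x := by
        rw [hG, mulVec_mulVec,
          nonsing_inv_mul _ ((isUnit_iff_isUnit_det (A x)).mp (hApd x).isUnit), one_mulVec]
      simp only [hSA, smul_mulVec, mulVec_smul, dotProduct_smul, smul_dotProduct, smul_eq_mul,
        hinv, dotProduct_comm (A x *ᵥ g u x)]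
      ring
    rw [hmu, hFI, hDI, Real.sqrt_mul (sq_nonneg κ), Real.sqrt_sq hκ.le, mul_left_comm,
      Real.mul_self_sqrt (hI0 u (hIcc hu))]
end
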